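/- arXiv:2006.11826 — 12 statements merged into one kernel-verified Lean document; each statement's English description precedes it below -/
import Mathlib

section
/- Let r₁, r₂ > 0 with r₁r₂ > 1 and let x₁, x₂ ∈ ℝ satisfy x₁ < r₂x₂ and x₁ < 0. Then the linear complementarity problem (find y₁, y₂, ℓ₁, ℓ₂ ≥ 0 with y₁ = x₁ + ℓ₁ + r₂ℓ₂, y₂ = x₂ + r₁ℓ₁ + ℓ₂, y₁ℓ₁ = 0, y₂ℓ₂ = 0) has the unique solution y₁ = 0, y₂ = x₂ − r₁x₁, ℓ₁ = −x₁, ℓ₂ = 0; moreover x₂ − r₁x₁ > 0. -/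
/-- The linear complementarity problem with data `(x₁, x₂)` and reflection
parameters `r₁, r₂`: find `y₁, y₂, ℓ₁, ℓ₂ ≥ 0` with `y₁ = x₁ + ℓ₁ + r₂ℓ₂`,
`y₂ = x₂ + r₁ℓ₁ + ℓ₂`, `y₁ℓ₁ = 0` and `y₂ℓ₂ = 0`. -/
def LCPSol (r₁ r₂ x₁ x₂ y₁ y₂ l₁ l₂ : ℝ) : Prop :=
  0 ≤ y₁ ∧ 0 ≤ y₂ ∧ 0 ≤ l₁ ∧ 0 ≤ l₂ ∧
    y₁ = x₁ + l₁ + r₂ * l₂ ∧ y₂ = x₂ + r₁ * l₁ + l₂ ∧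
    y₁ * l₁ = 0 ∧ y₂ * l₂ = 0

theorem lcp_unique_solution_red_region (r₁ r₂ x₁ x₂ : ℝ)
    (hr₁ : 0 < r₁) (hr₂ : 0 < r₂) (hr : 1 < r₁ * r₂)
    (hx : x₁ < r₂ * x₂) (hx₁ : x₁ < 0) :
    0 < x₂ - r₁ * x₁ ∧
    LCPSol r₁ r₂ x₁ x₂ 0 (x₂ - r₁ * x₁) (-x₁) 0 ∧
    ∀ y₁ y₂ l₁ l₂ : ℝ, LCPSol r₁ r₂ x₁ x₂ y₁ y₂ l₁ l₂ →
      y₁ = 0 ∧ y₂ = x₂ - r₁ * x₁ ∧ l₁ = -x₁ ∧ l₂ = 0 := by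
  refine ⟨?_, ⟨le_rfl, ?_, by linarith, le_rfl, by ring, by ring, by ring, by ring⟩, ?_⟩
  · exact pos_of_mul_pos_right (a := r₂) (by nlinarith) hr₂.le
  · exact (pos_of_mul_pos_right (a := r₂) (by nlinarith) hr₂.le).le
  · rintro y₁ y₂ l₁ l₂ ⟨h_y₁, -, h_l₁, -, e₁, e₂, c₁, c₂⟩
    have h_l₂ : l₂ = 0 := by
      refine (mul_eq_zero.mp c₂).resolve_left fun h ↦ ?_
      have h_eq : y₁ = (x₁ - r₂ * x₂) - (r₁ * r₂ - 1) * l₁ := by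
        linear_combination e₁ + r₂ * (h - e₂)
      have : 0 ≤ (r₁ * r₂ - 1) * l₁ := mul_nonneg (by linarith) h_l₁
      linarith
    subst h_l₂
    have h_y : y₁ = 0 := (mul_eq_zero.mp c₁).resolve_right fun h ↦ by
      subst h
      linarith
    have h_l : l₁ = -x₁ := by linarith
    subst h_l
    exact ⟨h_y, by linarith, rfl, rfl⟩
end

section
/- Let r₁, r₂ > 0 with r₁r₂ > 1 and let x₁, x₂ ∈ ℝ satisfy x₁ < 0, x₂ < 0, x₁ ≥ r₂x₂ and x₂ ≥ r₁x₁ (the wedge case). Then the linear complementarity problem (find y₁, y₂, ℓ₁, ℓ₂ ≥ 0 with y₁ = x₁ + ℓ₁ + r₂ℓ₂, y₂ = x₂ + r₁ℓ₁ + ℓ₂, y₁ℓ₁ = 0, y₂ℓ₂ = 0) has exactly three solutions, namely: (i) y₁ = y₂ = 0 with ℓ₁ = (x₁ − r₂x₂)/(r₁r₂ − 1), ℓ₂ = (x₂ − r₁x₁)/(r₁r₂ − 1); (ii) y₁ = x₁ − r₂x₂, y₂ = 0 with ℓ₁ = 0, ℓ₂ = −x₂; (iii) y₁ = 0, y₂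 = x₂ − r₁x₁ with ℓ₁ = −x₁, ℓ₂ = 0. -/
theorem lcp_three_solutions_wedge (r₁ r₂ x₁ x₂ : ℝ)
    (hr₁ : 0 < r₁) (hr₂ : 0 < r₂) (hr : 1 < r₁ * r₂)
    (hx₁ : x₁ < 0) (hx₂ : x₂ < 0)
    (hw₁ : r₂ * x₂ ≤ x₁) (hw₂ : r₁ * x₁ ≤ x₂) :
    ∀ y₁ y₂ l₁ l₂ : ℝ,
      LCPSol r₁ r₂ x₁ x₂ y₁ y₂ l₁ l₂ ↔
        ((y₁, y₂, l₁, l₂) =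
            (0, 0, (x₁ - r₂ * x₂) / (r₁ * r₂ - 1), (x₂ - r₁ * x₁) / (r₁ * r₂ - 1)) ∨
         (y₁, y₂, l₁, l₂) = (x₁ - r₂ * x₂, 0, 0, -x₂) ∨
         (y₁, y₂, l₁, l₂) = (0, x₂ - r₁ * x₁, -x₁, 0)) := by
  have hd : 0 < r₁ * r₂ - 1 := by linarith
  intro y₁ y₂ l₁ l₂
  simp only [LCPSol, Prod.mk.injEq]
  constructor
  · rintro ⟨hy₁, hy₂, hl₁, hl₂, h₁, h₂, hc₁, hc₂⟩
    rcases mul_eq_zero.mp hc₁ with hy₁z | hl₁z <;> rcases mul_eq_zero.mp hc₂ with hy₂z | hl₂z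
    · refine Or.inl ⟨hy₁z, hy₂z, ?_, ?_⟩
      · rw [eq_div_iff hd.ne']
        linear_combination h₁ - hy₁z - r₂ * (h₂ - hy₂z)
      · rw [eq_div_iff hd.ne']
        linear_combination h₂ - hy₂z - r₁ * (h₁ - hy₁z)
    · subst hl₂z
      have hl₁x : l₁ = -x₁ := by linarith
      subst hl₁x
      exact Or.inr (Or.inr ⟨hy₁z, by linarith, rfl, rfl⟩)
    · subst hl₁z
      have hl₂x : l₂ = -x₂ := by linarith
      subst hl₂x
      exact Or.inr (Or.inl ⟨by linarith, hy₂z, rfl, rfl⟩)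
    · subst hl₁z hl₂z
      linarith
  · rintro (⟨rfl, rfl, rfl, rfl⟩ | ⟨rfl, rfl, rfl, rfl⟩ | ⟨rfl, rfl, rfl, rfl⟩)
    · have h₁ := div_mul_cancel₀ (x₁ - r₂ * x₂) hd.ne'
      have h₂ := div_mul_cancel₀ (x₂ - r₁ * x₁) hd.ne'
      refine ⟨le_rfl, le_rfl, div_nonneg (by linarith) hd.le, div_nonneg (by linarith) hd.le,
        mul_right_cancel₀ hd.ne' ?_, mul_right_cancel₀ hd.ne' ?_, zero_mul _, zero_mul _⟩
      · linear_combination -h₁ - r₂ * h₂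
      · linear_combination -r₁ * h₁ - h₂
    · exact ⟨by linarith, le_rfl, le_rfl, by linarith, by ring, by ring, by ring, by ring⟩
    · exact ⟨le_rfl, by linarith, by linarith, le_rfl, by ring, by ring, by ring, by ring⟩
end

section
/- For any σ₁, σ₂ > 0, μ₁, μ₂ ∈ ℝ and ρ ∈ (0, 1), there exist positive reals c₁, c₂, q₁, q₂, q̄₁, q̄₂, λ, λ₁, λ₂ such that for i = 1, 2: cᵢ − λ/q̄ᵢ − λᵢ/qᵢ = μᵢ, 2λ/q̄ᵢ² + 2λᵢ/qᵢ² = σᵢ², and 2λ/(q̄₁q̄₂) = ρσ₁σ₂. (Equivalently, the drifted compound Poisson model with common shocks and these parameters has prescribed means μᵢ, variances σᵢ² and covariance ρσ₁σ₂ at time 1.) -/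
/-- Existence of parameters of the drifted compound Poisson model with common
shocks matching prescribed means `μᵢ`, variances `σᵢ²` and covariance `ρσ₁σ₂`. -/
theorem exists_compound_poisson_parameters_matching_moments
    (σ₁ σ₂ : ℝ) (hσ₁ : 0 < σ₁) (hσ₂ : 0 < σ₂)
    (μ₁ μ₂ : ℝ) (ρ : ℝ) (hρ : ρ ∈ Set.Ioo (0 : ℝ) 1) :
    ∃ c₁ c₂ q₁ q₂ qb₁ qb₂ lam lam₁ lam₂ : ℝ,
      0 < c₁ ∧ 0 < c₂ ∧ 0 < q₁ ∧ 0 < q₂ ∧ 0 < qb₁ ∧ 0 < qb₂ ∧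
      0 < lam ∧ 0 < lam₁ ∧ 0 < lam₂ ∧
      c₁ - lam / qb₁ - lam₁ / q₁ = μ₁ ∧
      c₂ - lam / qb₂ - lam₂ / q₂ = μ₂ ∧
      2 * lam / qb₁ ^ 2 + 2 * lam₁ / q₁ ^ 2 = σ₁ ^ 2 ∧
      2 * lam / qb₂ ^ 2 + 2 * lam₂ / q₂ ^ 2 = σ₂ ^ 2 ∧
      2 * lam / (qb₁ * qb₂) = ρ * σ₁ * σ₂ := by
  obtain ⟨hρ₀, hρ₁⟩ := hρ
  have hρ' : 0 < 1 - ρ := sub_pos.mpr hρ₁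
  obtain ⟨T, hT, hT₁, hT₂⟩ :
      ∃ T : ℝ, 0 < T ∧ 0 < μ₁ + T * σ₁ / 2 ∧ 0 < μ₂ + T * σ₂ / 2 := by
    have h₁ : 2 * (|μ₁| + 1) / σ₁ * σ₁ = 2 * (|μ₁| + 1) := div_mul_cancel₀ _ hσ₁.ne'
    have h₂ : 2 * (|μ₂| + 1) / σ₂ * σ₂ = 2 * (|μ₂| + 1) := div_mul_cancel₀ _ hσ₂.ne'
    have h₁₂ : 0 < 2 * (|μ₁| + 1) / σ₁ * σ₂ := by positivity
    have h₂₁ : 0 < 2 * (|μ₂| + 1) / σ₂ * σ₁ := by positivity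
    refine ⟨2 * (|μ₁| + 1) / σ₁ + 2 * (|μ₂| + 1) / σ₂, by positivity, ?_, ?_⟩
    · rw [add_mul]
      linarith [neg_abs_le μ₁]
    · rw [add_mul]
      linarith [neg_abs_le μ₂]
  refine ⟨μ₁ + T * σ₁ / 2, μ₂ + T * σ₂ / 2, T / σ₁, T / σ₂, T / σ₁, T / σ₂,
    ρ * T ^ 2 / 2, (1 - ρ) * T ^ 2 / 2, (1 - ρ) * T ^ 2 / 2, hT₁, hT₂,
    by positivity, by positivity, by positivity, by positivity, by positivity,
    by positivity, by positivity, ?_, ?_, ?_, ?_, ?_⟩ <;>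
  · field_simp
    try ring
end

section
/- Let σ₁, σ₂ > 0, μ₁, μ₂ ∈ ℝ, ρ ∈ (0, 1), and let λ, λ₁, λ₂, q̄₁, q̄₂, q₁, q₂ > 0 satisfy λ/q̄ᵢ² = ρσᵢ²/2 and λᵢ/qᵢ² = (1 − ρ)σᵢ²/2 for i = 1, 2. For each n ≥ 1 define the scaled parameters λ⁽ⁿ⁾ = λn, λᵢ⁽ⁿ⁾ = λᵢn, q̄ᵢ⁽ⁿ⁾ = q̄ᵢ√n, qᵢ⁽ⁿ⁾ = qᵢ√n, cᵢ⁽ⁿ⁾ = μᵢ + (λ/q̄ᵢ + λᵢ/qᵢ)√n, and set ψ⁽ⁿ⁾(s₁, s₂) = s₁c₁⁽ⁿ⁾ + s₂c₂⁽ⁿ⁾ − (λ⁽ⁿ⁾ + λ₁⁽ⁿ⁾ + λ₂⁽ⁿ⁾) + λ⁽ⁿ⁾/(1 + s₁/q̄₁⁽ⁿ⁾ + s₂/q̄₂⁽ⁿ⁾) + λ₁⁽ⁿ⁾/(1 + s₁/q₁⁽ⁿ⁾) + λ₂⁽ⁿ⁾/(1 + s₂/q₂⁽ⁿ⁾). Then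 for all s₁, s₂ ≥ 0, ψ⁽ⁿ⁾(s₁, s₂) converges as n → ∞ to (1/2)(σ₁²s₁² + 2ρσ₁σ₂s₁s₂ + σ₂²s₂²) + μ₁s₁ + μ₂s₂. -/
open Filter

/-- Second-order expansion of the Laplace exponent of a compensated compound Poisson process
with exponential jumps under diffusion scaling. -/
theorem tendsto_compensated_exponential_jumps (l a : ℝ) :
    Tendsto (fun n : ℕ => l * n / (1 + a / Real.sqrt n) - l * n + l * a * Real.sqrt n)
      atTop (nhds (l * a ^ 2)) := by
  have hsqrt : Tendsto (fun n : ℕ => Real.sqrt n) atTop atTop :=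
    Real.tendsto_sqrt_atTop.comp tendsto_natCast_atTop_atTop
  have hden : Tendsto (fun n : ℕ => 1 + a / Real.sqrt n) atTop (nhds 1) := by
    simpa using (hsqrt.const_div_atTop a).const_add 1
  have hlim : Tendsto (fun n : ℕ => l * a ^ 2 / (1 + a / Real.sqrt n)) atTop
      (nhds (l * a ^ 2)) := by
    simpa [Pi.div_def] using (tendsto_const_nhds (x := l * a ^ 2)).div hden one_ne_zero
  refine hlim.congr' ?_
  filter_upwards [hsqrt.eventually_gt_atTop 0, hden.eventually_ne one_ne_zero] with n hn hne
  have hsq : (n : ℝ) = Real.sqrt n ^ 2 := (Real.sq_sqrt n.cast_nonneg).symm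
  rw [hsq, Real.sqrt_sq hn.le]
  generalize Real.sqrt n = x at hn hne
  have hxa : x + a ≠ 0 := by
    intro h
    apply hne
    field_simp
    simpa using h
  field_simp
  ring

/-- The cross term `l / (p * q)` is determined by `l / p ^ 2` and `l / q ^ 2`. -/
theorem div_mul_eq_of_div_sq_eq {l p q c u v : ℝ} (hl : 0 ≤ l) (hp : 0 < p) (hq : 0 < q)
    (hc : 0 ≤ c) (hu : 0 ≤ u) (hv : 0 ≤ v) (h₁ : l / p ^ 2 = c * u ^ 2)
    (h₂ : l / q ^ 2 = c * v ^ 2) : l / (p * q) = c * (u * v) := by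
  rw [← sq_eq_sq₀ (by positivity) (by positivity)]
  calc (l / (p * q)) ^ 2 = (l / p ^ 2) * (l / q ^ 2) := by field_simp
    _ = (c * (u * v)) ^ 2 := by rw [h₁, h₂]; ring

/-- Convergence of the Laplace exponents of the scaled compound Poisson models with
common shocks to the Laplace exponent of a correlated Brownian motion with means
`μᵢ`, variances `σᵢ²` and correlation `ρ`. -/
theorem laplace_exponents_tendsto_brownian
    (σ₁ σ₂ μ₁ μ₂ ρ lam lam₁ lam₂ qb₁ qb₂ q₁ q₂ : ℝ)
    (hσ₁ : 0 < σ₁) (hσ₂ : 0 < σ₂) (hρ : ρ ∈ Set.Ioo (0 : ℝ) 1)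
    (hlam : 0 < lam) (hlam₁ : 0 < lam₁) (hlam₂ : 0 < lam₂)
    (hqb₁ : 0 < qb₁) (hqb₂ : 0 < qb₂) (hq₁ : 0 < q₁) (hq₂ : 0 < q₂)
    (hcov₁ : lam / qb₁ ^ 2 = ρ * σ₁ ^ 2 / 2)
    (hcov₂ : lam / qb₂ ^ 2 = ρ * σ₂ ^ 2 / 2)
    (hvar₁ : lam₁ / q₁ ^ 2 = (1 - ρ) * σ₁ ^ 2 / 2)
    (hvar₂ : lam₂ / q₂ ^ 2 = (1 - ρ) * σ₂ ^ 2 / 2)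
    (s₁ s₂ : ℝ) (hs₁ : 0 ≤ s₁) (hs₂ : 0 ≤ s₂) :
    Tendsto (fun n : ℕ =>
        s₁ * (μ₁ + (lam / qb₁ + lam₁ / q₁) * Real.sqrt n)
          + s₂ * (μ₂ + (lam / qb₂ + lam₂ / q₂) * Real.sqrt n)
          - (lam * n + lam₁ * n + lam₂ * n)
          + lam * n / (1 + s₁ / (qb₁ * Real.sqrt n) + s₂ / (qb₂ * Real.sqrt n))
          + lam₁ * n / (1 + s₁ / (q₁ * Real.sqrt n))
          + lam₂ * n / (1 + s₂ / (q₂ * Real.sqrt n)))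
      atTop
      (nhds ((1 / 2) * (σ₁ ^ 2 * s₁ ^ 2 + 2 * ρ * σ₁ * σ₂ * s₁ * s₂ + σ₂ ^ 2 * s₂ ^ 2)
        + μ₁ * s₁ + μ₂ * s₂)) := by
  have hcross : lam / (qb₁ * qb₂) = ρ / 2 * (σ₁ * σ₂) :=
    div_mul_eq_of_div_sq_eq hlam.le hqb₁ hqb₂ (by linarith [hρ.1]) hσ₁.le hσ₂.le
      (by rw [hcov₁]; ring) (by rw [hcov₂]; ring)
  have hlim := (((tendsto_compensated_exponential_jumps lam (s₁ / qb₁ + s₂ / qb₂)).add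
    (tendsto_compensated_exponential_jumps lam₁ (s₁ / q₁))).add
    (tendsto_compensated_exponential_jumps lam₂ (s₂ / q₂))).add_const (μ₁ * s₁ + μ₂ * s₂)
  convert hlim using 1
  · funext n
    have hshock : s₁ / (qb₁ * Real.sqrt n) + s₂ / (qb₂ * Real.sqrt n)
        = (s₁ / qb₁ + s₂ / qb₂) / Real.sqrt n := by
      rw [add_div, div_div, div_div]
    rw [add_assoc 1, hshock, ← div_div s₁ q₁, ← div_div s₂ q₂]
    ring
  · have hsum : lam * (s₁ / qb₁ + s₂ / qb₂) ^ 2 + lam₁ * (s₁ / q₁) ^ 2 + lam₂ * (s₂ / q₂) ^ 2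
        = lam / qb₁ ^ 2 * s₁ ^ 2 + lam / qb₂ ^ 2 * s₂ ^ 2 + 2 * (lam / (qb₁ * qb₂)) * s₁ * s₂
          + lam₁ / q₁ ^ 2 * s₁ ^ 2 + lam₂ / q₂ ^ 2 * s₂ ^ 2 := by
      field_simp
      ring
    rw [hsum, hcov₁, hcov₂, hvar₁, hvar₂, hcross]
    congr 1
    ring
end

section
/- Let c₁, c₂, λ₁, λ₂, q₁, q₂, r₁, r₂ > 0. Define ψ(s₁, s₂) = c₁s₁ + c₂s₂ − λ₁ − λ₂ + λ₁q₁/(q₁ + s₁) + λ₂q₂/(q₂ + s₂), ψ₁(s₁, s₂) = c₂ − λ₂q₂/((q₂ + s₂)(q₂ − r₂s₁)) and ψ₂(s₁, s₂) = c₁ − λ₁q₁/((q₁ + s₁)(q₁ − r₁s₂)). Then for all real (or complex) s₁ ∉ {0, −q₁, q₂/r₂} and s₂ ∉ {0, −q₂, q₁/r₁}: ψ(s₁, s₂)/(s₁s₂) = ψ₁(s₁, s₂)·(1/s₁ − r₂/q₂) + ψ₂(s₁, s₂)·(1/s₂ − r₁/q₁) + (c₁r₁/q₁ + c₂r₂/q₂).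 -/
/-- The factor `1 / s - r / q` cancels the pole `q - r * s` of a boundary kernel. -/
theorem boundary_kernel_mul {K : Type*} [Field K] (c l : K) {q r s t : K}
    (hq : q ≠ 0) (hs : s ≠ 0) (hqt : q + t ≠ 0) (hqr : q - r * s ≠ 0) :
    (c - l * q / ((q + t) * (q - r * s))) * (1 / s - r / q) =
      c / s - c * r / q - l / ((q + t) * s) := by
  field_simp

/-- The algebraic identity `ψ(s₁,s₂)/(s₁s₂) = ψ₁(s₁,s₂)(1/s₁ − r₂/q₂)
+ ψ₂(s₁,s₂)(1/s₂ − r₁/q₁) + (c₁r₁/q₁ + c₂r₂/q₂)` used to rewrite the Poissonian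
kernel equation in homogeneous form. -/
theorem poisson_kernel_homogeneous_identity
    (c₁ c₂ lam₁ lam₂ q₁ q₂ r₁ r₂ : ℝ)
    (hc₁ : 0 < c₁) (hc₂ : 0 < c₂) (hlam₁ : 0 < lam₁) (hlam₂ : 0 < lam₂)
    (hq₁ : 0 < q₁) (hq₂ : 0 < q₂) (hr₁ : 0 < r₁) (hr₂ : 0 < r₂)
    (s₁ s₂ : ℝ)
    (hs₁0 : s₁ ≠ 0) (hs₁q : s₁ ≠ -q₁) (hs₁r : s₁ ≠ q₂ / r₂)
    (hs₂0 : s₂ ≠ 0) (hs₂q : s₂ ≠ -q₂) (hs₂r : s₂ ≠ q₁ / r₁) :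
    (c₁ * s₁ + c₂ * s₂ - lam₁ - lam₂ + lam₁ * q₁ / (q₁ + s₁)
        + lam₂ * q₂ / (q₂ + s₂)) / (s₁ * s₂) =
      (c₂ - lam₂ * q₂ / ((q₂ + s₂) * (q₂ - r₂ * s₁))) * (1 / s₁ - r₂ / q₂)
        + (c₁ - lam₁ * q₁ / ((q₁ + s₁) * (q₁ - r₁ * s₂))) * (1 / s₂ - r₁ / q₁)
        + (c₁ * r₁ / q₁ + c₂ * r₂ / q₂) := by
  have hqs₁ : q₁ + s₁ ≠ 0 := fun h => hs₁q (by linarith)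
  have hqs₂ : q₂ + s₂ ≠ 0 := fun h => hs₂q (by linarith)
  have hqr₁ : q₁ - r₁ * s₂ ≠ 0 := fun h =>
    hs₂r ((eq_div_iff hr₁.ne').2 (by linarith))
  have hqr₂ : q₂ - r₂ * s₁ ≠ 0 := fun h =>
    hs₁r ((eq_div_iff hr₂.ne').2 (by linarith))
  rw [boundary_kernel_mul c₂ lam₂ hq₂.ne' hs₁0 hqs₂ hqr₂,
    boundary_kernel_mul c₁ lam₁ hq₁.ne' hs₂0 hqs₁ hqr₁]
  field_simp
  ring
end

section
/- Let c₁, c₂, λ₁, λ₂, q₁, q₂ > 0 with c₁ − λ₁/q₁ < 0 and c₂ − λ₂/q₂ < 0. Define a(s) = c₂(s + q₁), b(s) = c₁s² + (c₁q₁ + c₂q₂ − λ₁ − λ₂)s − λ₂q₁ + c₂q₂q₁, c(s) = c₁q₂s² + (c₁q₁ − λ₁)q₂s, and d(s) = b(s)² − 4a(s)c(s). Then there exist real numbers x₁ < x₂ < x₃ < x₄ such that d(xᵢ) = 0 for i = 1,…,4, with −q₁ < x₁, x₂ < 0, and −q₁ + √(λ₁q₁/c₁) < x₃; moreover d(s)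 < 0 for s ∈ (x₁, x₂) ∪ (x₃, x₄) and d(s) > 0 for s ∈ ℝ \ ([x₁, x₂] ∪ [x₃, x₄]). -/
/-- The discriminant `d = b² − 4ac` of the quadratic (in `s₂`) form of the kernel
of the compound Poisson model with independent components. -/
noncomputable def kernelDiscriminant (c₁ c₂ lam₁ lam₂ q₁ q₂ s : ℝ) : ℝ :=
  (c₁ * s ^ 2 + (c₁ * q₁ + c₂ * q₂ - lam₁ - lam₂) * s - lam₂ * q₁ + c₂ * q₂ * q₁) ^ 2
    - 4 * (c₂ * (s + q₁)) * (c₁ * q₂ * s ^ 2 + (c₁ * q₁ - lam₁) * q₂ * s)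

/-- For `c, l, q, w > 0` the quadratic `(t - q) (c t - l) - w t` has two positive roots,
one on each side of `q`. -/
theorem exists_roots_shifted_quadratic {c l q w : ℝ} (hc : 0 < c) (hl : 0 < l) (hq : 0 < q)
    (hw : 0 < w) :
    ∃ r₁ r₂ : ℝ, 0 < r₁ ∧ r₁ < q ∧ q < r₂ ∧ r₁ * r₂ = l * q / c ∧
      ∀ t : ℝ, (t - q) * (c * t - l) - w * t = c * ((t - r₁) * (t - r₂)) := by
  have hdisc : 0 < (c * q + l + w) ^ 2 - 4 * c * (l * q) := by
    have h₁ : 0 < w * (c * q + l) := by positivity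
    nlinarith [sq_nonneg (c * q - l), sq_nonneg w]
  obtain ⟨S, hS, hSq⟩ : ∃ S : ℝ, 0 < S ∧ S ^ 2 = (c * q + l + w) ^ 2 - 4 * c * (l * q) :=
    ⟨_, Real.sqrt_pos.2 hdisc, Real.sq_sqrt hdisc.le⟩
  obtain ⟨r₁, hr₁⟩ : ∃ r : ℝ, r = (c * q + l + w - S) / (2 * c) := ⟨_, rfl⟩
  obtain ⟨r₂, hr₂⟩ : ∃ r : ℝ, r = (c * q + l + w + S) / (2 * c) := ⟨_, rfl⟩
  have hlt : r₁ < r₂ := by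
    rw [hr₁, hr₂]
    gcongr
    linarith
  have hsum : c * (r₁ + r₂) = c * q + l + w := by
    rw [hr₁, hr₂]
    field_simp
    ring
  have hprod : r₁ * r₂ = l * q / c := by
    rw [hr₁, hr₂]
    field_simp
    linear_combination -hSq
  have hcprod : c * (r₁ * r₂) = l * q := by
    rw [hprod]
    field_simp
  have hfac : ∀ t : ℝ, (t - q) * (c * t - l) - w * t = c * ((t - r₁) * (t - r₂)) := fun t ↦ by
    linear_combination t * hsum - hcprod
  have hneg : (q - r₁) * (q - r₂) < 0 := by
    have h := hfac q
    have hwq : 0 < w * q := mul_pos hw hq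
    exact (pos_iff_neg_of_mul_neg (by linarith : c * ((q - r₁) * (q - r₂)) < 0)).1 hc
  rcases mul_neg_iff.1 hneg with ⟨h₁, h₂⟩ | ⟨h₁, h₂⟩
  · refine ⟨r₁, r₂, ?_, by linarith, by linarith, hprod, hfac⟩
    have hpos : 0 < r₁ * r₂ := by
      rw [hprod]
      positivity
    exact (pos_iff_pos_of_mul_pos hpos).2 (by linarith)
  · linarith

/-- The signs of a monic quartic with four ordered real roots. -/
theorem quartic_sign {x₁ x₂ x₃ x₄ : ℝ} (h₁₂ : x₁ < x₂) (h₂₃ : x₂ < x₃) (h₃₄ : x₃ < x₄) (s : ℝ) :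
    (s ∈ Set.Ioo x₁ x₂ ∪ Set.Ioo x₃ x₄ →
      (s - x₁) * (s - x₂) * ((s - x₃) * (s - x₄)) < 0) ∧
    (s ∉ Set.Icc x₁ x₂ ∪ Set.Icc x₃ x₄ →
      0 < (s - x₁) * (s - x₂) * ((s - x₃) * (s - x₄))) := by
  have hneg : ∀ {x y : ℝ}, x < s → s < y → (s - x) * (s - y) < 0 := fun hx hy ↦
    mul_neg_of_pos_of_neg (sub_pos.2 hx) (sub_neg.2 hy)
  have hleft : ∀ {x y : ℝ}, s < x → s < y → 0 < (s - x) * (s - y) := fun hx hy ↦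
    mul_pos_of_neg_of_neg (sub_neg.2 hx) (sub_neg.2 hy)
  have hright : ∀ {x y : ℝ}, x < s → y < s → 0 < (s - x) * (s - y) := fun hx hy ↦
    mul_pos (sub_pos.2 hx) (sub_pos.2 hy)
  constructor
  · rintro (⟨h₁, h₂⟩ | ⟨h₃, h₄⟩)
    · exact mul_neg_of_neg_of_pos (hneg h₁ h₂) (hleft (by linarith) (by linarith))
    · exact mul_neg_of_pos_of_neg (hright (by linarith) (by linarith)) (hneg h₃ h₄)
  · intro hs
    simp only [Set.mem_union, Set.mem_Icc, not_or, not_and_or, not_le] at hs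
    obtain ⟨h₁ | h₂, h₃ | h₄⟩ := hs
    · exact mul_pos (hleft h₁ (by linarith)) (hleft h₃ (by linarith))
    · linarith
    · exact mul_pos (hright (by linarith) h₂) (hleft h₃ (by linarith))
    · exact mul_pos (hright (by linarith) h₂) (hright (by linarith) h₄)

/-- The discriminant is the product of two quadratics in `s + q₁`, one for each branch
point `(√(c₂q₂) ± √λ₂)²` of the second coordinate. -/
theorem kernelDiscriminant_eq_mul {c₁ c₂ lam₁ lam₂ q₁ q₂ α β : ℝ} (hα : α ^ 2 = c₂ * q₂)
    (hβ : β ^ 2 = lam₂) (s : ℝ) :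
    kernelDiscriminant c₁ c₂ lam₁ lam₂ q₁ q₂ s =
      ((s + q₁ - q₁) * (c₁ * (s + q₁) - lam₁) - (β - α) ^ 2 * (s + q₁)) *
      ((s + q₁ - q₁) * (c₁ * (s + q₁) - lam₁) - (β + α) ^ 2 * (s + q₁)) := by
  have h : kernelDiscriminant c₁ c₂ lam₁ lam₂ q₁ q₂ s =
      (s * (c₁ * (s + q₁) - lam₁) + (c₂ * q₂ - lam₂) * (s + q₁)) ^ 2
        - 4 * (c₂ * q₂) * (s + q₁) * (s * (c₁ * (s + q₁) - lam₁)) := by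
    unfold kernelDiscriminant
    ring
  rw [h, ← hα, ← hβ]
  ring

/-- The discriminant has four real roots `x₁ < x₂ < x₃ < x₄` (the branch points),
with `−q₁ < x₁`, `x₂ < 0` and `−q₁ + √(λ₁q₁/c₁) < x₃`; the discriminant is negative
strictly between `x₁, x₂` and between `x₃, x₄`, and positive outside
`[x₁, x₂] ∪ [x₃, x₄]`. -/
theorem kernel_discriminant_roots
    (c₁ c₂ lam₁ lam₂ q₁ q₂ : ℝ)
    (hc₁ : 0 < c₁) (hc₂ : 0 < c₂) (hlam₁ : 0 < lam₁) (hlam₂ : 0 < lam₂)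
    (hq₁ : 0 < q₁) (hq₂ : 0 < q₂)
    (hμ₁ : c₁ - lam₁ / q₁ < 0) (hμ₂ : c₂ - lam₂ / q₂ < 0) :
    ∃ x₁ x₂ x₃ x₄ : ℝ,
      x₁ < x₂ ∧ x₂ < x₃ ∧ x₃ < x₄ ∧
      kernelDiscriminant c₁ c₂ lam₁ lam₂ q₁ q₂ x₁ = 0 ∧
      kernelDiscriminant c₁ c₂ lam₁ lam₂ q₁ q₂ x₂ = 0 ∧
      kernelDiscriminant c₁ c₂ lam₁ lam₂ q₁ q₂ x₃ = 0 ∧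
      kernelDiscriminant c₁ c₂ lam₁ lam₂ q₁ q₂ x₄ = 0 ∧
      -q₁ < x₁ ∧ x₂ < 0 ∧ -q₁ + Real.sqrt (lam₁ * q₁ / c₁) < x₃ ∧
      (∀ s : ℝ, s ∈ Set.Ioo x₁ x₂ ∪ Set.Ioo x₃ x₄ →
        kernelDiscriminant c₁ c₂ lam₁ lam₂ q₁ q₂ s < 0) ∧
      (∀ s : ℝ, s ∉ Set.Icc x₁ x₂ ∪ Set.Icc x₃ x₄ →
        0 < kernelDiscriminant c₁ c₂ lam₁ lam₂ q₁ q₂ s) := by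
  obtain ⟨α, hα, hαsq⟩ : ∃ α : ℝ, 0 < α ∧ α ^ 2 = c₂ * q₂ :=
    ⟨_, Real.sqrt_pos.2 (mul_pos hc₂ hq₂), Real.sq_sqrt (mul_pos hc₂ hq₂).le⟩
  obtain ⟨β, hβ, hβsq⟩ : ∃ β : ℝ, 0 < β ∧ β ^ 2 = lam₂ :=
    ⟨_, Real.sqrt_pos.2 hlam₂, Real.sq_sqrt hlam₂.le⟩
  have hαβ : α < β := by
    rw [← sq_lt_sq₀ hα.le hβ.le, hαsq, hβsq]
    exact (lt_div_iff₀ hq₂).1 (sub_neg.1 hμ₂)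
  obtain ⟨m₁, m₂, hm₁, hm₁q, hqm₂, hm, hmfac⟩ :=
    exists_roots_shifted_quadratic hc₁ hlam₁ hq₁ (pow_pos (sub_pos.2 hαβ) 2)
  obtain ⟨p₁, p₂, hp₁, hp₁q, hqp₂, -, hpfac⟩ :=
    exists_roots_shifted_quadratic hc₁ hlam₁ hq₁ (pow_pos (add_pos hβ hα) 2)
  have hlt : ∀ t : ℝ, 0 < t → (t - m₁) * (t - m₂) = 0 → (t - p₁) * (t - p₂) < 0 := by
    intro t ht h
    have h₁ := hmfac t
    rw [h] at h₁
    have h₂ := hpfac t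
    have h₃ : 0 < α * β * t := by positivity
    exact (pos_iff_neg_of_mul_neg
      (by nlinarith : c₁ * ((t - p₁) * (t - p₂)) < 0)).1 hc₁
  have hpm₁ : p₁ < m₁ := by
    have h := hlt m₁ hm₁ (by ring)
    by_contra! hle
    exact h.not_ge (mul_nonneg_of_nonpos_of_nonpos (by linarith) (by linarith))
  have hmp₂ : m₂ < p₂ := by
    have h := hlt m₂ (hq₁.trans hqm₂) (by ring)
    by_contra! hle
    exact h.not_ge (mul_nonneg (by linarith) (by linarith))
  have hfac : ∀ s, kernelDiscriminant c₁ c₂ lam₁ lam₂ q₁ q₂ s = c₁ ^ 2 *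
      ((s - (p₁ - q₁)) * (s - (m₁ - q₁)) * ((s - (m₂ - q₁)) * (s - (p₂ - q₁)))) := by
    intro s
    rw [kernelDiscriminant_eq_mul hαsq hβsq, hmfac, hpfac]
    ring
  have hsqrt : Real.sqrt (lam₁ * q₁ / c₁) < m₂ := by
    rw [← hm, Real.sqrt_lt' (by linarith), sq]
    exact mul_lt_mul_of_pos_right (by linarith) (by linarith)
  have hsign := quartic_sign (sub_lt_sub_right hpm₁ q₁)
    (sub_lt_sub_right (hm₁q.trans hqm₂) q₁) (sub_lt_sub_right hmp₂ q₁)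
  have hc₁sq : 0 < c₁ ^ 2 := pow_pos hc₁ 2
  refine ⟨p₁ - q₁, m₁ - q₁, m₂ - q₁, p₂ - q₁, by linarith, by linarith, by linarith,
    by simp [hfac], by simp [hfac], by simp [hfac], by simp [hfac],
    by linarith, by linarith, by linarith, fun s hs ↦ ?_, fun s hs ↦ ?_⟩
  · rw [hfac]
    exact mul_neg_of_pos_of_neg hc₁sq ((hsign s).1 hs)
  · rw [hfac]
    exact mul_pos hc₁sq ((hsign s).2 hs)
end

section
/- Let c₁, c₂, λ₁, λ₂, q₁, q₂, r₁, r₂ > 0 and set μ₁ = c₁ − λ₁/q₁, μ₂ = c₂ − λ₂/q₂. Assume μ₁ < 0, μ₂ < 0 and r₂|μ₂| > |μ₁|. Define the quadratic polynomial P(s) = (s − q₂/r₂)(s + q₁)(r₂c₂ − c₁) + λ₂(s + q₁) + λ₁(s − q₂/r₂). Then P(0) > 0, P(−q₁) < 0, and consequently there exists s₁ᵖ ∈ (−q₁, 0) with P(s₁ᵖ) = 0. -/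
/-- The polynomial `P(s) = (s − q₂/r₂)(s + q₁)(r₂c₂ − c₁) + λ₂(s + q₁) + λ₁(s − q₂/r₂)`
satisfies `P(0) > 0` and `P(−q₁) < 0`, and hence has a root `s₁ᵖ ∈ (−q₁, 0)`. -/
theorem pole_polynomial_has_root
    (c₁ c₂ lam₁ lam₂ q₁ q₂ r₁ r₂ : ℝ)
    (hc₁ : 0 < c₁) (hc₂ : 0 < c₂) (hlam₁ : 0 < lam₁) (hlam₂ : 0 < lam₂)
    (hq₁ : 0 < q₁) (hq₂ : 0 < q₂) (hr₁ : 0 < r₁) (hr₂ : 0 < r₂)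
    (hμ₁ : c₁ - lam₁ / q₁ < 0) (hμ₂ : c₂ - lam₂ / q₂ < 0)
    (hA2 : r₂ * |c₂ - lam₂ / q₂| > |c₁ - lam₁ / q₁|) :
    let P : ℝ → ℝ := fun s =>
      (s - q₂ / r₂) * (s + q₁) * (r₂ * c₂ - c₁) + lam₂ * (s + q₁) + lam₁ * (s - q₂ / r₂)
    0 < P 0 ∧ P (-q₁) < 0 ∧ ∃ s ∈ Set.Ioo (-q₁) (0 : ℝ), P s = 0 := by
  intro P
  rw [abs_of_neg hμ₁, abs_of_neg hμ₂] at hA2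
  have hP₀ : P 0 = q₁ * q₂ / r₂ * (r₂ * -(c₂ - lam₂ / q₂) - -(c₁ - lam₁ / q₁)) := by
    simp only [P]
    field_simp
    ring
  have h₀ : 0 < P 0 := by
    rw [hP₀]
    exact mul_pos (by positivity) (sub_pos.mpr hA2)
  have hPq : P (-q₁) = -(lam₁ * (q₁ + q₂ / r₂)) := by
    simp only [P]
    ring
  have hq : P (-q₁) < 0 := by
    rw [hPq]
    exact neg_neg_of_pos (by positivity)
  have hcont : Continuous P := by
    unfold P
    fun_prop
  exact ⟨h₀, hq, intermediate_value_Ioo (neg_nonpos.mpr hq₁.le) hcont.continuousOn ⟨hq, h₀⟩⟩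
end

section
/- Let c₁, c₂, λ₁, λ₂, q₁, q₂, r₁, r₂ > 0. Define ψ(s₁, s₂) = c₁s₁ + c₂s₂ − λ₁ − λ₂ + λ₁q₁/(q₁ + s₁) + λ₂q₂/(q₂ + s₂), ψ₁(s₁, s₂) = c₂ − λ₂q₂/((q₂ + s₂)(q₂ − r₂s₁)), and P(s) = (s − q₂/r₂)(s + q₁)(r₂c₂ − c₁) + λ₂(s + q₁) + λ₁(s − q₂/r₂). Then for all real s₁ ∉ {−q₁, q₂/r₂} and s₂ ≠ −q₂ the following equivalence holds: (ψ(s₁, s₂) = 0 and ψ₁(s₁, s₂) = 0) if and only if (s₁·P(s₁) = 0 and s₂ = λ₂q₂/(c₂(q₂ − r₂s₁)) − q₂). -/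
/-- The intersection of the kernel curve `ψ = 0` with the curve `ψ₁ = 0` is described
by the equations `s₁·P(s₁) = 0` and `s₂ = λ₂q₂/(c₂(q₂ − r₂s₁)) − q₂`. -/
theorem kernel_psi_one_intersection
    (c₁ c₂ lam₁ lam₂ q₁ q₂ r₁ r₂ : ℝ)
    (hc₁ : 0 < c₁) (hc₂ : 0 < c₂) (hlam₁ : 0 < lam₁) (hlam₂ : 0 < lam₂)
    (hq₁ : 0 < q₁) (hq₂ : 0 < q₂) (hr₁ : 0 < r₁) (hr₂ : 0 < r₂)
    (s₁ s₂ : ℝ) (hs₁q : s₁ ≠ -q₁) (hs₁r : s₁ ≠ q₂ / r₂) (hs₂ : s₂ ≠ -q₂) :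
    (c₁ * s₁ + c₂ * s₂ - lam₁ - lam₂ + lam₁ * q₁ / (q₁ + s₁)
        + lam₂ * q₂ / (q₂ + s₂) = 0 ∧
      c₂ - lam₂ * q₂ / ((q₂ + s₂) * (q₂ - r₂ * s₁)) = 0) ↔
    (s₁ * ((s₁ - q₂ / r₂) * (s₁ + q₁) * (r₂ * c₂ - c₁) + lam₂ * (s₁ + q₁)
        + lam₁ * (s₁ - q₂ / r₂)) = 0 ∧
      s₂ = lam₂ * q₂ / (c₂ * (q₂ - r₂ * s₁)) - q₂) := by
  have hA : q₁ + s₁ ≠ 0 := fun h => hs₁q (by linarith)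
  have hB : q₂ + s₂ ≠ 0 := fun h => hs₂ (by linarith)
  have hD : q₂ - r₂ * s₁ ≠ 0 := fun h => hs₁r (by
    rw [eq_div_iff hr₂.ne']
    linarith)
  have hpsi₁ : c₂ - lam₂ * q₂ / ((q₂ + s₂) * (q₂ - r₂ * s₁)) = 0 ↔
      c₂ * (q₂ + s₂) * (q₂ - r₂ * s₁) = lam₂ * q₂ := by
    rw [sub_eq_zero, eq_div_iff (mul_ne_zero hB hD), mul_assoc]
  have hs₂_iff : s₂ = lam₂ * q₂ / (c₂ * (q₂ - r₂ * s₁)) - q₂ ↔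
      c₂ * (q₂ + s₂) * (q₂ - r₂ * s₁) = lam₂ * q₂ := by
    rw [eq_sub_iff_add_eq, eq_div_iff (mul_ne_zero hc₂.ne' hD)]
    ring_nf
  rw [hpsi₁, hs₂_iff]
  refine and_congr_left fun h => ?_
  have hdiv : lam₂ * q₂ / (q₂ + s₂) = c₂ * (q₂ - r₂ * s₁) := by
    rw [div_eq_iff hB]
    linarith
  have key : (c₁ * s₁ + c₂ * s₂ - lam₁ - lam₂ + lam₁ * q₁ / (q₁ + s₁)
        + lam₂ * q₂ / (q₂ + s₂)) * ((q₂ - r₂ * s₁) * (q₁ + s₁)) =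
      r₂ * (s₁ * ((s₁ - q₂ / r₂) * (s₁ + q₁) * (r₂ * c₂ - c₁) + lam₂ * (s₁ + q₁)
        + lam₁ * (s₁ - q₂ / r₂))) := by
    rw [hdiv]
    field_simp
    linear_combination (q₁ + s₁) * h
  rw [← mul_eq_zero_iff_right (mul_ne_zero hD hA), key, mul_eq_zero_iff_left hr₂.ne']
end

section
/- Let σ₁, σ₂ > 0, μ₁ < 0, μ₂ < 0, r₁, r₂ > 0 with r₁|μ₁| > |μ₂| and r₂|μ₂| > |μ₁| (so r₁r₂ > 1). Set x₀ = −2μ₁/σ₁², y₀ = −2μ₂/σ₂², ψ₁(s₁, s₂) = μ₂ + (1/2)σ₂²(s₂ − r₂s₁), ψ₂(s₁, s₂) = μ₁ + (1/2)σ₁²(s₁ − r₁s₂), and c = (1/2)(r₁σ₁² + r₂σ₂²). Suppose real numbers A, B, p satisfy: 0 = ψ₁(x₀, 0)·A + c·p; μ₁/y₀ = −(r₂/2)σ₂² + ψ₂(0, y₀)·B + c·p; and 0 = ψ₁(x₀, y₀)·A + ψ₂(x₀, y₀)·B + c·p. Then p = r₁(r₂|μ₂| − |μ₁|)(σ₁²|μ₂|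 + r₂σ₂²|μ₁|) / ( |μ₁||μ₂|(r₁r₂ − 1)(r₁σ₁² + r₂σ₂²) ). -/
/-- The probability of total domination when starting at the origin for the reflected
Brownian model with independent components (`ρ = 0`), as the solution `p` of the three
linear equations obtained from evaluating the Brownian kernel equation at
`(x₀, 0+)`, `(0+, y₀)` and `(x₀, y₀)`. -/
theorem brownian_domination_probability_at_origin
    (σ₁ σ₂ μ₁ μ₂ r₁ r₂ : ℝ)
    (hσ₁ : 0 < σ₁) (hσ₂ : 0 < σ₂) (hμ₁ : μ₁ < 0) (hμ₂ : μ₂ < 0)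
    (hr₁ : 0 < r₁) (hr₂ : 0 < r₂)
    (hA2₁ : r₁ * |μ₁| > |μ₂|) (hA2₂ : r₂ * |μ₂| > |μ₁|)
    (A B p : ℝ)
    (heq₁ : 0 = (μ₂ + (1 / 2) * σ₂ ^ 2 * (0 - r₂ * (-(2 * μ₁) / σ₁ ^ 2))) * A
      + ((1 / 2) * (r₁ * σ₁ ^ 2 + r₂ * σ₂ ^ 2)) * p)
    (heq₂ : μ₁ / (-(2 * μ₂) / σ₂ ^ 2) =
      -(r₂ / 2) * σ₂ ^ 2
        + (μ₁ + (1 / 2) * σ₁ ^ 2 * (0 - r₁ * (-(2 * μ₂) / σ₂ ^ 2))) * B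
        + ((1 / 2) * (r₁ * σ₁ ^ 2 + r₂ * σ₂ ^ 2)) * p)
    (heq₃ : 0 =
      (μ₂ + (1 / 2) * σ₂ ^ 2 * ((-(2 * μ₂) / σ₂ ^ 2) - r₂ * (-(2 * μ₁) / σ₁ ^ 2))) * A
        + (μ₁ + (1 / 2) * σ₁ ^ 2 * ((-(2 * μ₁) / σ₁ ^ 2) - r₁ * (-(2 * μ₂) / σ₂ ^ 2))) * B
        + ((1 / 2) * (r₁ * σ₁ ^ 2 + r₂ * σ₂ ^ 2)) * p) :
    p = r₁ * (r₂ * |μ₂| - |μ₁|) * (σ₁ ^ 2 * |μ₂| + r₂ * σ₂ ^ 2 * |μ₁|)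
      / (|μ₁| * |μ₂| * (r₁ * r₂ - 1) * (r₁ * σ₁ ^ 2 + r₂ * σ₂ ^ 2)) := by
  rw [abs_of_neg hμ₁, abs_of_neg hμ₂] at *
  obtain ⟨m, rfl⟩ : ∃ m, μ₁ = -m := ⟨-μ₁, by ring⟩
  obtain ⟨n, rfl⟩ : ∃ n, μ₂ = -n := ⟨-μ₂, by ring⟩
  simp only [neg_neg] at *
  have hm : 0 < m := by linarith
  have hn : 0 < n := by linarith
  have ha : 0 < σ₁ ^ 2 := by positivity
  have hb : 0 < σ₂ ^ 2 := by positivity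
  generalize σ₁ ^ 2 = a at *
  generalize σ₂ ^ 2 = b at *
  have hr : 0 < r₁ * r₂ - 1 := by
    have h : 0 < (r₁ * r₂ - 1) * n := by nlinarith
    exact pos_of_mul_pos_left h hn.le
  have e₁ : 2 * (n * a + r₂ * b * m) * A = a * (r₁ * a + r₂ * b) * p := by
    field_simp at heq₁
    linarith
  have e₂ : 2 * n * (m * b + r₁ * a * n) * B
      = n * b * (r₁ * a + r₂ * b) * p - b ^ 2 * (r₂ * n - m) := by
    have h : -m / (-(2 * -n) / b) = -(m * b / (2 * n)) := by
      field_simp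
    rw [h] at heq₂
    field_simp at heq₂
    linarith
  have e₃ : 2 * (r₂ * b * m) * b * A + 2 * (r₁ * a * n) * a * B
      = a * b * (r₁ * a + r₂ * b) * p := by
    field_simp at heq₃
    linarith
  rw [eq_div_iff (by positivity)]
  have hk : n * a ^ 2 * b ^ 2 ≠ 0 := by positivity
  apply mul_left_cancel₀ hk
  linear_combination n * (n * a + r₂ * b * m) * (m * b + r₁ * a * n) * e₃
    - r₂ * b * m * b * n * (m * b + r₁ * a * n) * e₁
    - r₁ * a * n * a * (n * a + r₂ * b * m) * e₂
end

section
/- Let σ₁, σ₂ > 0, μ₁, μ₂ ∈ ℝ and ρ ∈ [0, 1). Let s₁ ∈ ℂ with Im s₁ ≠ 0 and s₂ ∈ ℝ satisfy (1/2)(σ₁²s₁² + 2ρσ₁σ₂s₁s₂ + σ₂²s₂²) + μ₁s₁ + μ₂s₂ = 0. Then, writing x = Re s₁ and y = Im s₁, the point (x, y) satisfies the hyperbola equation σ₁²σ₂²(ρ² − 1)x² + ρ²σ₁²σ₂²y² − 2(σ₂²μ₁ − ρσ₁σ₂μ₂)x = μ₁(σ₂²μ₁ − 2ρσ₁σ₂μ₂)/σ₁².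 -/
/-- Non-real complex zeros `s₁` of the Brownian kernel
`ψ(s₁, s₂) = (1/2)(σ₁²s₁² + 2ρσ₁σ₂s₁s₂ + σ₂²s₂²) + μ₁s₁ + μ₂s₂` with `s₂` real lie
on the hyperbola
`σ₁²σ₂²(ρ² − 1)x² + ρ²σ₁²σ₂²y² − 2(σ₂²μ₁ − ρσ₁σ₂μ₂)x = μ₁(σ₂²μ₁ − 2ρσ₁σ₂μ₂)/σ₁²`,
where `x = Re s₁` and `y = Im s₁`. -/
theorem brownian_kernel_nonreal_zeros_on_hyperbola
    (σ₁ σ₂ μ₁ μ₂ ρ : ℝ) (hσ₁ : 0 < σ₁) (hσ₂ : 0 < σ₂)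
    (hρ : ρ ∈ Set.Ico (0 : ℝ) 1)
    (s₁ : ℂ) (hs₁ : s₁.im ≠ 0) (s₂ : ℝ)
    (hker : (1 / 2 : ℂ) * ((σ₁ : ℂ) ^ 2 * s₁ ^ 2
        + 2 * (ρ : ℂ) * (σ₁ : ℂ) * (σ₂ : ℂ) * s₁ * (s₂ : ℂ)
        + (σ₂ : ℂ) ^ 2 * (s₂ : ℂ) ^ 2)
      + (μ₁ : ℂ) * s₁ + (μ₂ : ℂ) * (s₂ : ℂ) = 0) :
    σ₁ ^ 2 * σ₂ ^ 2 * (ρ ^ 2 - 1) * s₁.re ^ 2 + ρ ^ 2 * σ₁ ^ 2 * σ₂ ^ 2 * s₁.im ^ 2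
        - 2 * (σ₂ ^ 2 * μ₁ - ρ * σ₁ * σ₂ * μ₂) * s₁.re =
      μ₁ * (σ₂ ^ 2 * μ₁ - 2 * ρ * σ₁ * σ₂ * μ₂) / σ₁ ^ 2 := by
  have hre := congrArg Complex.re hker
  have him := congrArg Complex.im hker
  simp [pow_two] at hre him
  have hlin : σ₁ ^ 2 * s₁.re + ρ * σ₁ * σ₂ * s₂ + μ₁ = 0 :=
    mul_left_cancel₀ hs₁ (by linear_combination him)
  have hne : σ₁ ≠ 0 := hσ₁.ne'
  rw [eq_div_iff (pow_ne_zero 2 hne)]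
  linear_combination (-2 * ρ ^ 2 * σ₁ ^ 2 * σ₂ ^ 2) * hre
    + (2 * ρ ^ 2 * σ₁ ^ 2 * σ₂ ^ 2 * s₁.re
      + σ₂ ^ 2 * (ρ * σ₁ * σ₂ * s₂ - σ₁ ^ 2 * s₁.re - μ₁)
      + 2 * ρ * σ₁ * σ₂ * μ₂) * hlin
end

section
/- Let q̄₁, q̄₂, s₁, s₂ > 0 and let p : ℝ² → ℝ be a bounded measurable function. Then ∫₀^∞ ∫₀^∞ ∫₀^{min(q̄₁u, q̄₂v)} p(u − x/q̄₁, v − x/q̄₂) · e^{−x − s₁u − s₂v} dx dv du = (1 + s₁/q̄₁ + s₂/q̄₂)^{−1} · ∫₀^∞ ∫₀^∞ p(u, v) · e^{−s₁u − s₂v} dv du. -/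
open MeasureTheory

/-- Averaging the translates `F (y - a x)` of an integrable function against an integrable
weight `g x` commutes with integration over the plane. -/
theorem integral_integral_translate_mul (a : ℝ → ℝ × ℝ) (ha : Measurable a)
    (g : ℝ → ℝ) (hg : Integrable g) (F : ℝ × ℝ → ℝ) (hF : Integrable F) :
    ∫ u : ℝ, ∫ v : ℝ, ∫ x : ℝ, g x * F ((u, v) - a x) = (∫ x, g x) * ∫ y, F y := by
  have hmp : MeasurePreserving (fun z : ℝ × (ℝ × ℝ) => (z.1, z.2 - a z.1))
      ((volume : Measure ℝ).prod (volume : Measure (ℝ × ℝ)))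
      ((volume : Measure ℝ).prod (volume : Measure (ℝ × ℝ))) :=
    (MeasurePreserving.id volume).skew_product (g := fun x y => y - a x)
      (by fun_prop)
      (Filter.Eventually.of_forall fun x => (measurePreserving_sub_right volume (a x)).map_eq)
  have hH : Integrable (fun z : ℝ × (ℝ × ℝ) => g z.1 * F (z.2 - a z.1))
      ((volume : Measure ℝ).prod (volume : Measure (ℝ × ℝ))) :=
    hmp.integrable_comp_of_integrable (hg.mul_prod hF)
  have hK : Integrable (fun y : ℝ × ℝ => ∫ x : ℝ, g x * F (y - a x)) := hH.integral_prod_right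
  calc ∫ u : ℝ, ∫ v : ℝ, ∫ x : ℝ, g x * F ((u, v) - a x)
      = ∫ y : ℝ × ℝ, ∫ x : ℝ, g x * F (y - a x) := (integral_prod _ hK).symm
    _ = ∫ x : ℝ, ∫ y : ℝ × ℝ, g x * F (y - a x) :=
        (integral_integral_swap (f := fun (x : ℝ) (y : ℝ × ℝ) => g x * F (y - a x)) hH).symm
    _ = (∫ x, g x) * ∫ y, F y := by
        simp_rw [integral_const_mul, integral_sub_right_eq_self F, integral_mul_const]

/-- The integral identity for the term `I₁` in the derivation of the Poissonian kernel
equation: a common exponential jump scaled by `1/q̄₁, 1/q̄₂` that keeps the process in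
the quadrant multiplies the double Laplace transform by `(1 + s₁/q̄₁ + s₂/q̄₂)⁻¹`. -/
theorem common_jump_integral_identity
    (qb₁ qb₂ s₁ s₂ : ℝ) (hqb₁ : 0 < qb₁) (hqb₂ : 0 < qb₂)
    (hs₁ : 0 < s₁) (hs₂ : 0 < s₂)
    (p : ℝ × ℝ → ℝ) (hp : Measurable p) (M : ℝ) (hM : ∀ z, |p z| ≤ M) :
    ∫ u in Set.Ioi (0 : ℝ), ∫ v in Set.Ioi (0 : ℝ),
        ∫ x in Set.Ioc (0 : ℝ) (min (qb₁ * u) (qb₂ * v)),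
          p (u - x / qb₁, v - x / qb₂) * Real.exp (-x - s₁ * u - s₂ * v) =
      (1 + s₁ / qb₁ + s₂ / qb₂)⁻¹ *
        ∫ u in Set.Ioi (0 : ℝ), ∫ v in Set.Ioi (0 : ℝ),
          p (u, v) * Real.exp (-(s₁ * u) - s₂ * v) := by
  set c : ℝ := 1 + s₁ / qb₁ + s₂ / qb₂ with hc
  have hcpos : 0 < c := by positivity
  set f : ℝ × ℝ → ℝ := fun y => p y * Real.exp (-(s₁ * y.1) - s₂ * y.2) with hf
  set Q : Set (ℝ × ℝ) := Set.Ioi 0 ×ˢ Set.Ioi 0 with hQ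
  have hQm : MeasurableSet Q := measurableSet_Ioi.prod measurableSet_Ioi
  have hfQ : IntegrableOn f Q := by
    have hexp : IntegrableOn (fun y : ℝ × ℝ => Real.exp (-s₁ * y.1) * Real.exp (-s₂ * y.2)) Q := by
      rw [IntegrableOn, hQ, Measure.volume_eq_prod, ← Measure.prod_restrict]
      exact (exp_neg_integrableOn_Ioi 0 hs₁).mul_prod (exp_neg_integrableOn_Ioi 0 hs₂)
    refine (hexp.bdd_mul hp.aestronglyMeasurable
      (Filter.Eventually.of_forall hM)).congr (Filter.Eventually.of_forall fun y => ?_)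
    simp only [hf, ← Real.exp_add]
    ring_nf
  set g : ℝ → ℝ := (Set.Ioi 0).indicator fun x => Real.exp (-c * x) with hg
  have hgi : Integrable g :=
    (exp_neg_integrableOn_Ioi 0 hcpos).integrable_indicator measurableSet_Ioi
  have hgval : ∫ x, g x = c⁻¹ := by
    rw [hg, integral_indicator measurableSet_Ioi, integral_exp_mul_Ioi (by linarith) 0]
    simp
  have hFval : ∫ y, Q.indicator f y = ∫ u in Set.Ioi (0 : ℝ), ∫ v in Set.Ioi (0 : ℝ), f (u, v) := by
    rw [integral_indicator hQm]
    exact setIntegral_prod f hfQ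
  have key := integral_integral_translate_mul (fun x => (x / qb₁, x / qb₂)) (by fun_prop)
    g hgi (Q.indicator f) (hfQ.integrable_indicator hQm)
  rw [hgval, hFval] at key
  refine Eq.trans ?_ key
  have hzero : ∀ u v : ℝ, u ≤ 0 ∨ v ≤ 0 →
      ∀ x : ℝ, g x * Q.indicator f ((u, v) - (x / qb₁, x / qb₂)) = 0 := by
    intro u v huv x
    rcases le_or_gt x 0 with hx | hx
    · simp [hg, hx]
    · have h1 : 0 < x / qb₁ := by positivity
      have h2 : 0 < x / qb₂ := by positivity
      rw [Set.indicator_of_notMem, mul_zero]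
      rintro ⟨hu, hv⟩
      simp only [Prod.mk_sub_mk, Set.mem_Ioi] at hu hv
      rcases huv with h | h <;> linarith
  have hinner : ∀ u v : ℝ,
      ∫ x in Set.Ioc (0 : ℝ) (min (qb₁ * u) (qb₂ * v)),
          p (u - x / qb₁, v - x / qb₂) * Real.exp (-x - s₁ * u - s₂ * v) =
        ∫ x, g x * Q.indicator f ((u, v) - (x / qb₁, x / qb₂)) := by
    intro u v
    rw [integral_Ioc_eq_integral_Ioo, ← integral_indicator measurableSet_Ioo]
    congr 1 with x
    have hmem : x ∈ Set.Ioo 0 (min (qb₁ * u) (qb₂ * v)) ↔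
        x ∈ Set.Ioi 0 ∧ (u, v) - (x / qb₁, x / qb₂) ∈ Q := by
      simp [hQ, div_lt_iff₀' hqb₁, div_lt_iff₀' hqb₂]
    by_cases hx : x ∈ Set.Ioo 0 (min (qb₁ * u) (qb₂ * v))
    · obtain ⟨h1, h2⟩ := hmem.1 hx
      rw [Set.indicator_of_mem hx, hg, Set.indicator_of_mem h1, Set.indicator_of_mem h2]
      simp only [hf, Prod.mk_sub_mk]
      rw [mul_left_comm, ← Real.exp_add]
      congr 2
      rw [hc]
      ring
    · rw [Set.indicator_of_notMem hx]
      by_cases h1 : x ∈ Set.Ioi 0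
      · rw [Set.indicator_of_notMem fun h2 => hx (hmem.2 ⟨h1, h2⟩), mul_zero]
      · rw [hg, Set.indicator_of_notMem h1, zero_mul]
  simp_rw [hinner]
  rw [setIntegral_eq_integral_of_forall_compl_eq_zero]
  · congr 1 with u
    refine setIntegral_eq_integral_of_forall_compl_eq_zero fun v hv => ?_
    simp only [hzero u v (.inr (not_lt.1 hv)), integral_zero]
  · intro u hu
    simp only [hzero u _ (.inl (not_lt.1 hu)), integral_zero]
end

section
/- Let q₁, r₁, s₁, s₂ > 0 with s₂ ≠ q₁/r₁, and let g : [0,∞) → ℝ be a bounded measurable function. Define G(s) = ∫₀^∞ g(z)·e^{−sz} dz for s > 0. Then ∫₀^∞ ∫₀^∞ ∫_{q₁u}^∞ g(v + r₁(x/q₁ − u)) · e^{−x − s₁u − s₂v} dx dv du = ( (1/q₁) / ((1 + s₁/q₁)(r₁s₂/q₁ − 1)) ) · ( G(q₁/r₁) − G(s₂) ). -/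
open MeasureTheory

theorem setIntegral_Ioi_comp_mul_add (F : ℝ → ℝ) {a : ℝ} (ha : 0 < a) (d v : ℝ) :
    ∫ x in Set.Ioi (a * v + d), F x = a * ∫ z in Set.Ioi v, F (a * z + d) := by
  have hshift := (measurePreserving_add_right volume d).setIntegral_preimage_emb
    (measurableEmbedding_addRight d) F (Set.Ioi (a * v + d))
  have hpre : (fun x => x + d) ⁻¹' Set.Ioi (a * v + d) = Set.Ioi (a * v) := by
    ext x
    simp
  rw [← hshift, hpre, ← integral_comp_mul_left_Ioi' (fun x => F (x + d)) v ha, smul_eq_mul]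

theorem integrableOn_Ioi_mul_exp_neg {g : ℝ → ℝ} (hg : Measurable g) {M : ℝ}
    (hM : ∀ z, |g z| ≤ M) {s : ℝ} (hs : 0 < s) :
    IntegrableOn (fun z => g z * Real.exp (-(s * z))) (Set.Ioi 0) := by
  have hexp : IntegrableOn (fun z : ℝ => Real.exp (-(s * z))) (Set.Ioi 0) := by
    simpa only [neg_mul] using exp_neg_integrableOn_Ioi 0 hs
  exact hexp.bdd_mul hg.aestronglyMeasurable (Filter.Eventually.of_forall hM)

theorem setIntegral_Ioo_exp {a s : ℝ} (hne : s ≠ a) {z : ℝ} (hz : 0 < z) :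
    ∫ v in Set.Ioo 0 z, Real.exp (-(a * (z - v)) - s * v) =
      (Real.exp (-(a * z)) - Real.exp (-(s * z))) / (s - a) := by
  have hsub : s - a ≠ 0 := sub_ne_zero.mpr hne
  rw [← integral_Ioc_eq_integral_Ioo, ← intervalIntegral.integral_of_le hz.le,
    intervalIntegral.integral_eq_sub_of_hasDerivAt
      (f := fun v => -Real.exp (-(a * (z - v)) - s * v) / (s - a))]
  · simp only [sub_self, mul_zero, neg_zero, sub_zero, zero_sub]
    ring
  · intro v _
    have hlin : HasDerivAt (fun v => -(a * (z - v)) - s * v) (a - s) v := by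
      have := ((((hasDerivAt_id v).const_sub z).const_mul a).neg).sub
        ((hasDerivAt_id v).const_mul s)
      simpa using! this
    convert! (hlin.exp.neg.div_const (s - a)) using 1
    field_simp
    ring
  · exact (by fun_prop : Continuous _).intervalIntegrable _ _

theorem integrable_indicator_Ioi_mul_exp {g : ℝ → ℝ} (hg : Measurable g) {M : ℝ}
    (hM : ∀ z, |g z| ≤ M) {a s : ℝ} (ha : 0 < a) (hs : 0 < s) :
    Integrable (Function.uncurry fun v z : ℝ => (Set.Ioi v).indicator
        (fun z => g z * Real.exp (-(a * (z - v)) - s * v)) z)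
      ((volume.restrict (Set.Ioi (0 : ℝ))).prod (volume.restrict (Set.Ioi (0 : ℝ)))) := by
  set m := min a s / 2 with hm
  have hm0 : 0 < m := by positivity
  have hma : 2 * m ≤ a := by linarith [min_le_left a s]
  have hms : 2 * m ≤ s := by linarith [min_le_right a s]
  have hexp : IntegrableOn (fun x : ℝ => Real.exp (-m * x)) (Set.Ioi 0) :=
    exp_neg_integrableOn_Ioi 0 hm0
  have hdom := (hexp.mul_prod hexp).const_mul M
  refine hdom.mono' ?_ ?_
  · have heq : (Function.uncurry fun v z : ℝ => (Set.Ioi v).indicator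
        (fun z => g z * Real.exp (-(a * (z - v)) - s * v)) z) =
        {p : ℝ × ℝ | p.1 < p.2}.indicator
          (fun p => g p.2 * Real.exp (-(a * (p.2 - p.1)) - s * p.1)) := by
      ext ⟨v, z⟩
      simp [Set.indicator_apply]
    rw [heq]
    refine (Measurable.indicator ?_ (measurableSet_lt measurable_fst measurable_snd)
      ).aestronglyMeasurable
    fun_prop
  · rw [Measure.prod_restrict]
    refine (ae_restrict_iff' (measurableSet_Ioi.prod measurableSet_Ioi)).mpr
      (Filter.Eventually.of_forall ?_)
    rintro ⟨v, z⟩ ⟨hv, -⟩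
    have hM0 : 0 ≤ M := (abs_nonneg _).trans (hM 0)
    simp only [Set.mem_Ioi] at hv
    simp only [Function.uncurry_apply_pair, Set.indicator_apply, Set.mem_Ioi]
    split_ifs with hvz
    · rw [norm_mul, Real.norm_eq_abs, Real.norm_eq_abs, Real.abs_exp, ← Real.exp_add]
      refine mul_le_mul (hM z) (Real.exp_le_exp.mpr ?_) (Real.exp_pos _).le hM0
      have h₁ := mul_le_mul_of_nonneg_right hma (sub_nonneg.mpr hvz.le)
      have h₂ := mul_le_mul_of_nonneg_right hms hv.le
      have h₃ := mul_nonneg hm0.le (sub_nonneg.mpr hvz.le)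
      linarith
    · rw [norm_zero]
      positivity

theorem setIntegral_setIntegral_Ioi_mul_exp {g : ℝ → ℝ} (hg : Measurable g) {M : ℝ}
    (hM : ∀ z, |g z| ≤ M) {a s : ℝ} (ha : 0 < a) (hs : 0 < s) (hne : s ≠ a) :
    ∫ v in Set.Ioi (0 : ℝ), ∫ z in Set.Ioi v, g z * Real.exp (-(a * (z - v)) - s * v) =
      ((∫ z in Set.Ioi (0 : ℝ), g z * Real.exp (-(a * z))) -
        ∫ z in Set.Ioi (0 : ℝ), g z * Real.exp (-(s * z))) / (s - a) := by
  calc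
    _ = ∫ v in Set.Ioi (0 : ℝ), ∫ z in Set.Ioi (0 : ℝ), (Set.Ioi v).indicator
          (fun z => g z * Real.exp (-(a * (z - v)) - s * v)) z := by
      refine setIntegral_congr_fun measurableSet_Ioi fun v hv => ?_
      rw [setIntegral_indicator measurableSet_Ioi, Set.Ioi_inter_Ioi,
        sup_eq_right.mpr (Set.mem_Ioi.mp hv).le]
    _ = ∫ z in Set.Ioi (0 : ℝ), ∫ v in Set.Ioi (0 : ℝ), (Set.Ioi v).indicator
          (fun z => g z * Real.exp (-(a * (z - v)) - s * v)) z :=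
      integral_integral_swap (integrable_indicator_Ioi_mul_exp hg hM ha hs)
    _ = ∫ z in Set.Ioi (0 : ℝ),
          (g z * Real.exp (-(a * z)) - g z * Real.exp (-(s * z))) / (s - a) := by
      refine setIntegral_congr_fun measurableSet_Ioi fun z hz => ?_
      have hflip : ∀ v, (Set.Ioi v).indicator
          (fun z => g z * Real.exp (-(a * (z - v)) - s * v)) z =
          (Set.Iio z).indicator (fun v => g z * Real.exp (-(a * (z - v)) - s * v)) v := by
        intro v
        simp [Set.indicator_apply]
      simp only [hflip]
      rw [setIntegral_indicator measurableSet_Iio, Set.Ioi_inter_Iio, integral_const_mul,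
        setIntegral_Ioo_exp hne hz]
      ring
    _ = _ := by
      rw [integral_div, integral_sub (integrableOn_Ioi_mul_exp_neg hg hM ha)
        (integrableOn_Ioi_mul_exp_neg hg hM hs)]

/-- The integral identity for the term `I₉` in the derivation of the Poissonian kernel
equation: an individual exponential jump of rate `q₁` in the first coordinate
overshooting the boundary, the overshoot being reflected into the second coordinate
with coefficient `r₁`. -/
theorem overshoot_reflection_integral_identity
    (q₁ r₁ s₁ s₂ : ℝ) (hq₁ : 0 < q₁) (hr₁ : 0 < r₁)
    (hs₁ : 0 < s₁) (hs₂ : 0 < s₂) (hne : s₂ ≠ q₁ / r₁)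
    (g : ℝ → ℝ) (hg : Measurable g) (M : ℝ) (hM : ∀ z, |g z| ≤ M) :
    let G : ℝ → ℝ := fun s => ∫ z in Set.Ioi (0 : ℝ), g z * Real.exp (-(s * z))
    ∫ u in Set.Ioi (0 : ℝ), ∫ v in Set.Ioi (0 : ℝ), ∫ x in Set.Ioi (q₁ * u),
        g (v + r₁ * (x / q₁ - u)) * Real.exp (-x - s₁ * u - s₂ * v) =
      (1 / q₁) / ((1 + s₁ / q₁) * (r₁ * s₂ / q₁ - 1)) * (G (q₁ / r₁) - G s₂) := by
  intro G
  have ha : 0 < q₁ / r₁ := div_pos hq₁ hr₁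
  have hinner : ∀ u v : ℝ, ∫ x in Set.Ioi (q₁ * u),
      g (v + r₁ * (x / q₁ - u)) * Real.exp (-x - s₁ * u - s₂ * v) =
      q₁ / r₁ * Real.exp (-(q₁ + s₁) * u) *
        ∫ z in Set.Ioi v, g z * Real.exp (-(q₁ / r₁ * (z - v)) - s₂ * v) := by
    intro u v
    rw [show q₁ * u = q₁ / r₁ * v + (q₁ * u - q₁ / r₁ * v) by ring,
      setIntegral_Ioi_comp_mul_add _ ha, mul_assoc]
    congr 1
    rw [← integral_const_mul]
    refine integral_congr_ae (Filter.Eventually.of_forall fun z => ?_)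
    beta_reduce
    rw [mul_left_comm, ← Real.exp_add]
    congr 2
    · field_simp
      ring
    · ring
  simp only [hinner, integral_const_mul, integral_mul_const,
    setIntegral_setIntegral_Ioi_mul_exp hg hM ha hs₂ hne]
  rw [integral_exp_mul_Ioi (by linarith)]
  have h₁ : s₂ - q₁ / r₁ ≠ 0 := sub_ne_zero.mpr hne
  have h₂ : r₁ * s₂ / q₁ - 1 = (s₂ - q₁ / r₁) * (r₁ / q₁) := by
    field_simp
  have h₃ : q₁ + s₁ ≠ 0 := by positivity
  have h₄ : 1 + s₁ / q₁ = (q₁ + s₁) / q₁ := by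
    field_simp
  rw [h₂, h₄, mul_zero, Real.exp_zero, neg_div_neg_eq]
  change _ * ((G (q₁ / r₁) - G s₂) / _) = _
  generalize G (q₁ / r₁) - G s₂ = D
  generalize s₂ - q₁ / r₁ = e at h₁
  field_simp
end
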